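/- Let X be a nonempty finite metric space with phase change numbers s₀ = 0 < s₁ < ⋯ < s_U, and let M ≤ U be an index such that V_s(X) is connected for all s ≥ s_M. Let c ≥ 0 satisfy c < s_{i+1} − s_i for all 0 ≤ i < M. Then the map sending a layer point (s,S) of L₀X[c] to (t,S), where t = min{r ≥ 0 : S is a connected component of V_r(X)} (this minimum exists), is an order isomorphism from Λ(L₀X[c]) onto Λ(L₀X). -/

import Mathlib

open Metric in
/-- The edge relation at scale `s` of the graph with vertex set `V`
(inside an ambient metric space): an edge between distinct vertices at distance `≤ s`. -/
def adjRel {Y : Type*} [MetricSpace Y] (V : Set Y) (s : ℝ) (a b : Y) : Prop :=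
  a ∈ V ∧ b ∈ V ∧ a ≠ b ∧ dist a b ≤ s

/-- Reachability (a path of edges) in the graph with vertex set `V` and edges
between distinct vertices at distance `≤ s`. -/
def Reach {Y : Type*} [MetricSpace Y] (V : Set Y) (s : ℝ) (a b : Y) : Prop :=
  Relation.ReflTransGen (adjRel V s) a b

/-- `S` is (the vertex set of) a connected component of the graph with vertex
set `V` and edges between distinct vertices at distance `≤ s`.
For `V = X` this graph is the Vietoris–Rips graph `V_s(X)`. -/
def IsCC {Y : Type*} [MetricSpace Y] (V : Set Y) (s : ℝ) (S : Set Y) : Prop :=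
  ∃ a ∈ V, S = {b | Reach V s a b}

/-- The vertex set of the Lesnick graph `L_{s,k}(Y)`: the points of `Y` having at
least `k` distinct `s`-neighbours in `Y`. -/
def lesnickVerts (Y : Type*) [MetricSpace Y] (k : ℕ) (s : ℝ) : Set Y :=
  {y | k ≤ Set.ncard {y' : Y | y' ≠ y ∧ dist y y' ≤ s}}

/-- The directional Hausdorff distance `h(Y, X) = max_{y ∈ Y} min_{x ∈ X} d(y, x)`. -/
noncomputable def dirHaus {Y : Type*} [MetricSpace Y] (X : Set Y) : ℝ :=
  ⨆ y : Y, ⨅ x : X, dist y (x : Y)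

/-- `N_k(X, Y) = max_{x ∈ X} min_S max_{y ∈ S} d(x, y)`, the minimum over all
`(k+1)`-element subsets `S ⊆ Y`. -/
noncomputable def Nk {Y : Type*} [MetricSpace Y] (k : ℕ) (X : Set Y) : ℝ :=
  ⨆ x : X, ⨅ S : {S : Finset Y // S.card = k + 1}, ⨆ y : (S : Finset Y), dist (x : Y) (y : Y)

/-- The poset `Λ(L₀X[c])` of layer points of the truncated Vietoris–Rips clustering:
pairs `(s, S)` with `s ≥ c`, `S` a connected component of `V_s(X)`, and `S` not a
component of `V_r(X)` for any `c ≤ r < s`; ordered as a subset of `ℝ × Set Y`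
(componentwise: `≤` on parameters and `⊆` on clusters). `Λ(L₀X) = Λ(L₀X[0])`. -/
def LambdaVR {Y : Type*} [MetricSpace Y] (X : Set Y) (c : ℝ) : Set (ℝ × Set Y) :=
  {p | c ≤ p.1 ∧ IsCC X p.1 p.2 ∧ ∀ r : ℝ, c ≤ r → r < p.1 → ¬ IsCC X r p.2}

/-- The poset `Λ(L_kY)` of layer points of the Lesnick clustering of `Y`:
pairs `(t, T)` with `t ≥ 0`, `T` a connected component of `L_{t,k}(Y)`, and `T` not
a component of `L_{r,k}(Y)` for any `0 ≤ r < t`; ordered componentwise. -/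
def LambdaLes (Y : Type*) [MetricSpace Y] (k : ℕ) : Set (ℝ × Set Y) :=
  {p | 0 ≤ p.1 ∧ IsCC (lesnickVerts Y k p.1) p.1 p.2 ∧
    ∀ r : ℝ, 0 ≤ r → r < p.1 → ¬ IsCC (lesnickVerts Y k r) r p.2}

theorem Reach.symm {Y : Type*} [MetricSpace Y] {V : Set Y} {s : ℝ} {a b : Y}
    (h : Reach V s a b) : Reach V s b a :=
  have : Std.Symm (adjRel V s) :=
    ⟨fun _ _ h => ⟨h.2.1, h.1, h.2.2.1.symm, (dist_comm _ _).trans_le h.2.2.2⟩⟩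
  Relation.ReflTransGen.stdSymm.symm _ _ h

theorem Reach.mono {Y : Type*} [MetricSpace Y] {V : Set Y} {s t : ℝ} (hst : s ≤ t) {a b : Y}
    (h : Reach V s a b) : Reach V t a b :=
  Relation.ReflTransGen.mono (fun _ _ h => ⟨h.1, h.2.1, h.2.2.1, h.2.2.2.trans hst⟩) _ _ h

theorem IsCC.nonempty {Y : Type*} [MetricSpace Y] {V : Set Y} {s : ℝ} {S : Set Y}
    (hS : IsCC V s S) : S.Nonempty := by
  obtain ⟨a, -, rfl⟩ := hS
  exact ⟨a, Relation.ReflTransGen.refl⟩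

/-- A component that meets a component at a larger scale is contained in it. -/
theorem IsCC.subset_of_mem {Y : Type*} [MetricSpace Y] {V : Set Y} {s t : ℝ} (hst : s ≤ t)
    {S T : Set Y} (hS : IsCC V s S) (hT : IsCC V t T) {x : Y} (hxS : x ∈ S) (hxT : x ∈ T) :
    S ⊆ T := by
  obtain ⟨a, -, rfl⟩ := hS
  obtain ⟨b, -, rfl⟩ := hT
  intro y hy
  exact Relation.ReflTransGen.trans hxT
    (Reach.mono hst (Relation.ReflTransGen.trans (Reach.symm hxS) hy))

theorem isCC_congr {Y : Type*} [MetricSpace Y] {V : Set Y} {s t : ℝ}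
    (h : ∀ x y : Y, dist x y ≤ s ↔ dist x y ≤ t) (S : Set Y) : IsCC V s S ↔ IsCC V t S := by
  have hadj : (adjRel V s : Y → Y → Prop) = adjRel V t := by
    ext a b
    simp only [adjRel, h]
  simp only [IsCC, Reach, hadj]

/-- Layer points are ordered by inclusion of their clusters. -/
theorem fst_le_of_snd_subset {Y : Type*} [MetricSpace Y] {V : Set Y} {c : ℝ} {p q : ℝ × Set Y}
    (hp : p ∈ LambdaVR V c) (hq : q ∈ LambdaVR V c) (h : p.2 ⊆ q.2) : p.1 ≤ q.1 := by
  by_contra! hlt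
  obtain ⟨x, hx⟩ := hp.2.1.nonempty
  have hqp := hq.2.1.subset_of_mem hlt.le hp.2.1 (h hx) hx
  exact hp.2.2 q.1 hq.1 hlt (h.antisymm hqp ▸ hq.2.1)

/-- Every component at a scale at least `c` has a birth scale among those at least `c`. -/
theorem exists_mem_lambdaVR {Y : Type*} [MetricSpace Y] [Finite Y] {V : Set Y}
    {c r : ℝ} (hc : 0 ≤ c) (hr : c ≤ r) {S : Set Y} (hS : IsCC V r S) :
    ∃ s, (s, S) ∈ LambdaVR V c := by
  have hround : ∀ r, c ≤ r → IsCC V r S →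
      ∃ z : Y × Y, max c (dist z.1 z.2) ≤ r ∧ IsCC V (max c (dist z.1 z.2)) S := by
    intro r hr hS
    obtain ⟨a, -⟩ := hS.nonempty
    obtain ⟨z, hz, hmax⟩ := Set.exists_max_image {z : Y × Y | dist z.1 z.2 ≤ r}
      (fun z => dist z.1 z.2) (Set.toFinite _) ⟨(a, a), by simpa using hc.trans hr⟩
    have hzr : max c (dist z.1 z.2) ≤ r := max_le hr hz
    refine ⟨z, hzr, (isCC_congr (fun x y => ⟨fun h => h.trans hzr, fun h => ?_⟩) S).2 hS⟩
    exact (hmax (x, y) h).trans (le_max_right _ _)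
  obtain ⟨z₀, -, hz₀⟩ := hround r hr hS
  obtain ⟨z, hz, hmin⟩ := Set.exists_min_image
    {z : Y × Y | IsCC V (max c (dist z.1 z.2)) S}
    (fun z => max c (dist z.1 z.2)) (Set.toFinite _) ⟨z₀, hz₀⟩
  refine ⟨max c (dist z.1 z.2), le_max_left _ _, hz, fun q hcq hq hqS => ?_⟩
  obtain ⟨w, hwq, hw⟩ := hround q hcq hqS
  exact absurd (hmin w hw) (not_le.2 (hwq.trans_lt hq))

/-- If consecutive scales at which the graph changes are more than `c` apart until the graph
becomes connected, every component persists to some scale at least `c`. -/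
theorem exists_isCC_ge {X : Type*} [MetricSpace X]
    {U M : ℕ} {σ : ℕ → ℝ} (hσ0 : σ 0 = 0)
    (hσmono : ∀ i j : ℕ, i < j → j ≤ U → σ i < σ j)
    (hσrange : {r : ℝ | ∃ x x' : X, r = dist x x'} = σ '' {i : ℕ | i ≤ U})
    (hMU : M ≤ U)
    (hconn : ∀ s : ℝ, σ M ≤ s → IsCC (Set.univ : Set X) s (Set.univ : Set X))
    {c : ℝ} (hc : 0 ≤ c) (hgap : ∀ i : ℕ, i < M → c < σ (i + 1) - σ i)
    {r : ℝ} (hr : 0 ≤ r) {S : Set X} (hS : IsCC Set.univ r S) :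
    ∃ t, c ≤ t ∧ IsCC Set.univ t S := by
  rcases le_or_gt (σ M) r with hMr | hrM
  · obtain ⟨x, hx⟩ := hS.nonempty
    have hSuniv : S = Set.univ := Set.univ_subset_iff.1
      ((hconn r hMr).subset_of_mem le_rfl hS (Set.mem_univ x) hx)
    exact ⟨max c (σ M), le_max_left _ _, hSuniv ▸ hconn _ (le_max_right _ _)⟩
  · have hlt : ∃ j, r < σ j := ⟨M, hrM⟩
    obtain ⟨i, hi⟩ : ∃ i, Nat.find hlt = i + 1 := Nat.exists_eq_succ_of_ne_zero fun h => by
      have := Nat.find_spec hlt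
      rw [h, hσ0] at this
      linarith
    have hri : r < σ (i + 1) := hi ▸ Nat.find_spec hlt
    have hir : σ i ≤ r := not_lt.1 (Nat.find_min hlt (by omega))
    have hiM : i + 1 ≤ M := hi ▸ Nat.find_min' hlt hrM
    have hmono : StrictMonoOn σ (Set.Iic U) := fun j _ k hk hjk => hσmono j k hjk hk
    have hmem : ∀ j ≤ M, j ∈ Set.Iic U := fun j hj => hj.trans hMU
    have hσi : 0 ≤ σ i := hσ0 ▸ (hmono.le_iff_le (hmem 0 (by omega)) (hmem i (by omega))).2
      (Nat.zero_le i)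
    have key : ∀ t, σ i ≤ t → t < σ (i + 1) → ∀ x y : X, dist x y ≤ t ↔ dist x y ≤ σ i := by
      intro t hit hti x y
      refine ⟨fun h => ?_, fun h => h.trans hit⟩
      obtain ⟨j, hj, hjxy⟩ := hσrange.subset ⟨x, y, rfl⟩
      rw [← hjxy] at h ⊢
      have hji := (hmono.lt_iff_lt hj (hmem (i + 1) hiM)).1 (h.trans_lt hti)
      exact (hmono.le_iff_le hj (hmem i (by omega))).2 (by omega)
    have hgi := hgap i hiM
    refine ⟨σ i + c, by linarith, ?_⟩
    rw [isCC_congr (key (σ i + c) (by linarith) (by linarith)), ← isCC_congr (key r hir hri)]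
    exact hS

/-- If `c ≥ 0` satisfies `c < s_{i+1} − s_i` for all `i < M` (where
`s₀ = 0 < s₁ < ⋯ < s_U` are the phase change numbers of `X` and `V_s(X)` is
connected for `s ≥ s_M`), then the map sending a layer point `(s,S)` of `L₀X[c]` to
`(t,S)`, where `t = min {r ≥ 0 : S is a component of V_r(X)}` (this minimum exists),
is an order isomorphism `Λ(L₀X[c]) ≅ Λ(L₀X)`. -/
theorem statement19 {X : Type*} [MetricSpace X] [Fintype X] [Nonempty X]
    (U M : ℕ) (σ : ℕ → ℝ) (hσ0 : σ 0 = 0)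
    (hσmono : ∀ i j : ℕ, i < j → j ≤ U → σ i < σ j)
    (hσrange : {r : ℝ | ∃ x x' : X, r = dist x x'} = σ '' {i : ℕ | i ≤ U})
    (hMU : M ≤ U)
    (hconn : ∀ s : ℝ, σ M ≤ s → IsCC (Set.univ : Set X) s (Set.univ : Set X))
    (c : ℝ) (hc : 0 ≤ c) (hgap : ∀ i : ℕ, i < M → c < σ (i + 1) - σ i) :
    ∃ e : (LambdaVR (Set.univ : Set X) c) ≃o (LambdaVR (Set.univ : Set X) 0),
      ∀ p : LambdaVR (Set.univ : Set X) c,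
        ((e p : ℝ × Set X).2 = (p : ℝ × Set X).2) ∧
        IsLeast {r : ℝ | 0 ≤ r ∧ IsCC (Set.univ : Set X) r (p : ℝ × Set X).2}
          (e p : ℝ × Set X).1 := by
  choose! f hf using fun (S : Set X) (h : ∃ r, 0 ≤ r ∧ IsCC Set.univ r S) =>
    let ⟨_, hr, hS⟩ := h
    exists_mem_lambdaVR le_rfl hr hS
  have hΛ : ∀ p : LambdaVR (Set.univ : Set X) c, (f p.1.2, p.1.2) ∈ LambdaVR Set.univ 0 :=
    fun p => hf _ ⟨p.1.1, hc.trans p.2.1, p.2.2.1⟩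
  let g : LambdaVR (Set.univ : Set X) c ↪o LambdaVR (Set.univ : Set X) 0 :=
    OrderEmbedding.ofMapLEIff (fun p => ⟨(f p.1.2, p.1.2), hΛ p⟩) fun p q =>
      ⟨fun h => ⟨fst_le_of_snd_subset p.2 q.2 h.2, h.2⟩,
        fun h => ⟨fst_le_of_snd_subset (hΛ p) (hΛ q) h.2, h.2⟩⟩
  have hg : Function.Surjective g := by
    rintro ⟨⟨t, S⟩, h⟩
    obtain ⟨r, hr, hS⟩ :=
      exists_isCC_ge hσ0 hσmono hσrange hMU hconn hc hgap h.1 h.2.1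
    obtain ⟨s, hs⟩ := exists_mem_lambdaVR hc hr hS
    have hfS := hΛ ⟨(s, S), hs⟩
    refine ⟨⟨(s, S), hs⟩, Subtype.ext (Prod.ext ?_ rfl)⟩
    exact (fst_le_of_snd_subset hfS h subset_rfl).antisymm
      (fst_le_of_snd_subset h hfS subset_rfl)
  refine ⟨RelIso.ofSurjective g hg, fun p => ⟨rfl, ⟨(hΛ p).1, (hΛ p).2.1⟩, fun r hr => ?_⟩⟩
  exact not_lt.1 fun hlt => (hΛ p).2.2 r hr.1 hlt hr.2
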